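/- (Tunnel Theorem.) Suppose A_x = −I. Then a tuple (X, U, V, Ψ_A, Ψ_d) satisfies the first-order necessary (KKT) conditions of the discretized problem (P^{D,N}) — namely primal feasibility A_x X + A_v V = C and f(X_i,U_i) − V_i = 0 for all i, together with stationarity of the Lagrangian L in (X,U,V) — if and only if, under the transformation Λ := Q⁻¹Ψ_d and Ω := Q⁻¹Ψ_A, the tuple (X, U, V, Λ, Ω) solves the discretized primal-dual system (P^{λ,D,N}) with dual discretization matrices A*_λ := −I and A*_ω := A_v† and zero right-hand side, i.e.: A_x X + A_v V = C; A*_λ Λ + A*_ω Ω = 0; f(X_i, U_i) − V_i = 0 for all i; ∂_x H(Λ_i, X_i, U_i) − Ω_i = 0 for all i; and ∂_u H(Λ_i, X_i, U_i) = 0 for all i. -/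

import Mathlib

open Matrix Function BigOperators

/-- The Q-adjoint `M† := Q⁻¹ Mᵀ Q` with `Q = diag q`. -/
noncomputable def Qadj {N : ℕ} (q : Fin (N+1) → ℝ) (M : Matrix (Fin (N+1)) (Fin (N+1)) ℝ) :
    Matrix (Fin (N+1)) (Fin (N+1)) ℝ :=
  (Matrix.diagonal q)⁻¹ * Mᵀ * Matrix.diagonal q

/-- The Hamiltonian `H(λ, x, u) := F(x,u) + λ·f(x,u)`. -/
noncomputable def Ham (F f : ℝ → ℝ → ℝ) (lam x u : ℝ) : ℝ := F x u + lam * f x u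

/-- Partial derivative of the Hamiltonian in `x`. -/
noncomputable def Hx (F f : ℝ → ℝ → ℝ) (lam x u : ℝ) : ℝ :=
  deriv (fun s => Ham F f lam s u) x

/-- Partial derivative of the Hamiltonian in `u`. -/
noncomputable def Hu (F f : ℝ → ℝ → ℝ) (lam x u : ℝ) : ℝ :=
  deriv (fun s => Ham F f lam x s) u

/-- Lagrangian of the discretized problem `(P^{D,N})`. -/
noncomputable def Lag {N : ℕ} (q : Fin (N+1) → ℝ) (F f : ℝ → ℝ → ℝ)
    (Ax Av : Matrix (Fin (N+1)) (Fin (N+1)) ℝ) (C : Fin (N+1) → ℝ)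
    (X U V ΨA Ψd : Fin (N+1) → ℝ) : ℝ :=
  (∑ i, q i * F (X i) (U i))
    + (∑ i, ΨA i * (Ax *ᵥ X + Av *ᵥ V - C) i)
    + (∑ i, Ψd i * (f (X i) (U i) - V i))

lemma hasDerivAt_sum_update {n : ℕ} (G : Fin n → ℝ → ℝ) (X : Fin n → ℝ) (i : Fin n) (d : ℝ)
    (h : HasDerivAt (G i) d (X i)) :
    HasDerivAt (fun s => ∑ j, G j (update X i s j)) d (X i) := by
  have e : (fun s => ∑ j, G j (update X i s j))
      = fun s => G i s + ∑ j ∈ Finset.univ.erase i, G j (X j) := by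
    funext s
    rw [← Finset.add_sum_erase _ _ (Finset.mem_univ i)]
    congr 1
    · simp
    · refine Finset.sum_congr rfl fun j hj => ?_
      rw [update_of_ne (Finset.ne_of_mem_erase hj)]
  rw [e]
  exact h.add_const _

/-- **Tunnel Theorem.** Suppose `A_x = −I`. Then `(X, U, V, Ψ_A, Ψ_d)` satisfies the KKT
conditions of `(P^{D,N})` (primal feasibility plus stationarity of the Lagrangian) iff,
under `Λ := Q⁻¹Ψ_d` and `Ω := Q⁻¹Ψ_A`, the tuple `(X, U, V, Λ, Ω)` solves the discretized
primal-dual system `(P^{λ,D,N})` with `A*_λ := −I`, `A*_ω := A_v†`, and zero right-hand side. -/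
theorem tunnel_theorem (N : ℕ) (q : Fin (N+1) → ℝ) (hq : ∀ i, 0 < q i)
    (F f : ℝ → ℝ → ℝ)
    (hF : Differentiable ℝ (fun p : ℝ × ℝ => F p.1 p.2))
    (hf : Differentiable ℝ (fun p : ℝ × ℝ => f p.1 p.2))
    (Ax Av : Matrix (Fin (N+1)) (Fin (N+1)) ℝ) (C : Fin (N+1) → ℝ)
    (hAx : Ax = -(1 : Matrix (Fin (N+1)) (Fin (N+1)) ℝ))
    (X U V ΨA Ψd : Fin (N+1) → ℝ) :
    (Ax *ᵥ X + Av *ᵥ V = C ∧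
     (∀ i, f (X i) (U i) - V i = 0) ∧
     (∀ i, deriv (fun s => Lag q F f Ax Av C (update X i s) U V ΨA Ψd) (X i) = 0) ∧
     (∀ i, deriv (fun s => Lag q F f Ax Av C X (update U i s) V ΨA Ψd) (U i) = 0) ∧
     (∀ i, deriv (fun s => Lag q F f Ax Av C X U (update V i s) ΨA Ψd) (V i) = 0)) ↔
    (Ax *ᵥ X + Av *ᵥ V = C ∧
     (-(1 : Matrix (Fin (N+1)) (Fin (N+1)) ℝ)) *ᵥ ((Matrix.diagonal q)⁻¹ *ᵥ Ψd)
        + Qadj q Av *ᵥ ((Matrix.diagonal q)⁻¹ *ᵥ ΨA) = 0 ∧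
     (∀ i, f (X i) (U i) - V i = 0) ∧
     (∀ i, Hx F f (((Matrix.diagonal q)⁻¹ *ᵥ Ψd) i) (X i) (U i)
        - ((Matrix.diagonal q)⁻¹ *ᵥ ΨA) i = 0) ∧
     (∀ i, Hu F f (((Matrix.diagonal q)⁻¹ *ᵥ Ψd) i) (X i) (U i) = 0)) := by
  have hD : (Matrix.diagonal q)⁻¹ = Matrix.diagonal (fun i => (q i)⁻¹) := by
    apply Matrix.inv_eq_right_inv
    rw [Matrix.diagonal_mul_diagonal, ← Matrix.diagonal_one]
    congr 1
    funext i
    exact mul_inv_cancel₀ (hq i).ne'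
  have hdx : ∀ {g : ℝ → ℝ → ℝ}, Differentiable ℝ (fun p : ℝ × ℝ => g p.1 p.2) →
      ∀ x u, HasDerivAt (fun s => g s u) (deriv (fun s => g s u) x) x := by
    intro g hg x u
    have : Differentiable ℝ (fun s : ℝ => g s u) :=
      hg.comp (f := fun s : ℝ => (s, u)) (by fun_prop)
    exact (this x).hasDerivAt
  have hdu : ∀ {g : ℝ → ℝ → ℝ}, Differentiable ℝ (fun p : ℝ × ℝ => g p.1 p.2) →
      ∀ x u, HasDerivAt (fun s => g x s) (deriv (fun s => g x s) u) u := by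
    intro g hg x u
    have : Differentiable ℝ (fun s : ℝ => g x s) :=
      hg.comp (f := fun s : ℝ => (x, s)) (by fun_prop)
    exact (this u).hasDerivAt
  have hX : ∀ i, deriv (fun s => Lag q F f Ax Av C (update X i s) U V ΨA Ψd) (X i)
      = q i * deriv (fun s => F s (U i)) (X i) - ΨA i
        + Ψd i * deriv (fun s => f s (U i)) (X i) := by
    intro i
    have key := hasDerivAt_sum_update
      (fun j x => q j * F x (U j) + ΨA j * (-x + (Av *ᵥ V) j - C j) + Ψd j * (f x (U j) - V j))
      X i _ ((((hdx hF (X i) (U i)).const_mul (q i)).add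
        (((((hasDerivAt_id (X i)).neg).add_const ((Av *ᵥ V) i)).sub_const (C i)).const_mul
          (ΨA i))).add (((hdx hf (X i) (U i)).sub_const (V i)).const_mul (Ψd i)))
    have e : (fun s => Lag q F f Ax Av C (update X i s) U V ΨA Ψd) = _ :=
      funext fun s => by
        rw [Lag, ← Finset.sum_add_distrib, ← Finset.sum_add_distrib]
    rw [e]
    simp only [hAx, Matrix.neg_mulVec, Matrix.one_mulVec, Pi.add_apply, Pi.sub_apply, Pi.neg_apply]
    rw [key.deriv]
    ring
  have hU : ∀ i, deriv (fun s => Lag q F f Ax Av C X (update U i s) V ΨA Ψd) (U i)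
      = q i * deriv (fun s => F (X i) s) (U i)
        + Ψd i * deriv (fun s => f (X i) s) (U i) := by
    intro i
    have key := hasDerivAt_sum_update
      (fun j u => q j * F (X j) u + ΨA j * (Ax *ᵥ X + Av *ᵥ V - C) j + Ψd j * (f (X j) u - V j))
      U i _ ((((hdu hF (X i) (U i)).const_mul (q i)).add_const
        (ΨA i * (Ax *ᵥ X + Av *ᵥ V - C) i)).add
          (((hdu hf (X i) (U i)).sub_const (V i)).const_mul (Ψd i)))
    have e : (fun s => Lag q F f Ax Av C X (update U i s) V ΨA Ψd) = _ :=
      funext fun s => by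
        rw [Lag, ← Finset.sum_add_distrib, ← Finset.sum_add_distrib]
    rw [e, key.deriv]
  have hV : ∀ i, deriv (fun s => Lag q F f Ax Av C X U (update V i s) ΨA Ψd) (V i)
      = (Avᵀ *ᵥ ΨA) i - Ψd i := by
    intro i
    have key := hasDerivAt_sum_update
      (fun j v => q j * F (X j) (U j) + ΨA j * ((Ax *ᵥ X) j - C j) + (Avᵀ *ᵥ ΨA) j * v
        + Ψd j * (f (X j) (U j) - v))
      V i _ (((((hasDerivAt_id (V i)).const_mul ((Avᵀ *ᵥ ΨA) i)).const_add
        (q i * F (X i) (U i) + ΨA i * ((Ax *ᵥ X) i - C i)))).add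
          (((hasDerivAt_id (V i)).const_sub (f (X i) (U i))).const_mul (Ψd i)))
    have e : (fun s => Lag q F f Ax Av C X U (update V i s) ΨA Ψd)
        = fun s => ∑ j, (q j * F (X j) (U j) + ΨA j * ((Ax *ᵥ X) j - C j)
          + (Avᵀ *ᵥ ΨA) j * (update V i s j) + Ψd j * (f (X j) (U j) - update V i s j)) := by
      funext s
      have h1 : ∑ j, ΨA j * (Av *ᵥ update V i s) j = ∑ j, (Avᵀ *ᵥ ΨA) j * update V i s j := by
        have := Matrix.dotProduct_mulVec ΨA Av (update V i s)
        rw [← Matrix.mulVec_transpose] at this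
        exact this
      have h2 : ∑ j, ΨA j * (Ax *ᵥ X + Av *ᵥ update V i s - C) j
          = ∑ j, ΨA j * ((Ax *ᵥ X) j - C j) + ∑ j, ΨA j * (Av *ᵥ update V i s) j := by
        rw [← Finset.sum_add_distrib]
        refine Finset.sum_congr rfl fun j _ => ?_
        simp only [Pi.add_apply, Pi.sub_apply]
        ring
      rw [Lag, h2, h1]
      simp only [Finset.sum_add_distrib]
      ring
    rw [e, key.deriv]
    ring
  have hHx : ∀ l x u, Hx F f l x u = deriv (fun s => F s u) x + l * deriv (fun s => f s u) x :=
    fun l x u => ((hdx hF x u).add ((hdx hf x u).const_mul l)).deriv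
  have hHu : ∀ l x u, Hu F f l x u = deriv (fun s => F x s) u + l * deriv (fun s => f x s) u :=
    fun l x u => ((hdu hF x u).add ((hdu hf x u).const_mul l)).deriv
  have hA : Qadj q Av *ᵥ ((Matrix.diagonal q)⁻¹ *ᵥ ΨA)
      = (Matrix.diagonal q)⁻¹ *ᵥ (Avᵀ *ᵥ ΨA) := by
    have h1 : Matrix.diagonal q * (Matrix.diagonal q)⁻¹ = 1 := by
      rw [hD, Matrix.diagonal_mul_diagonal, ← Matrix.diagonal_one]
      congr 1
      funext i
      exact mul_inv_cancel₀ (hq i).ne'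
    rw [Qadj, Matrix.mulVec_mulVec, Matrix.mulVec_mulVec, Matrix.mul_assoc, h1, Matrix.mul_one]
  have c1 : (∀ i, (Avᵀ *ᵥ ΨA) i - Ψd i = 0) ↔
      (-(1 : Matrix (Fin (N+1)) (Fin (N+1)) ℝ)) *ᵥ ((Matrix.diagonal q)⁻¹ *ᵥ Ψd)
        + Qadj q Av *ᵥ ((Matrix.diagonal q)⁻¹ *ᵥ ΨA) = 0 := by
    rw [hA, hD, funext_iff]
    refine forall_congr' fun i => ?_
    simp only [Matrix.neg_mulVec, Matrix.one_mulVec, Pi.add_apply, Pi.neg_apply,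
      Matrix.mulVec_diagonal, Pi.zero_apply]
    rw [show -((q i)⁻¹ * Ψd i) + (q i)⁻¹ * (Avᵀ *ᵥ ΨA) i
      = (q i)⁻¹ * ((Avᵀ *ᵥ ΨA) i - Ψd i) by ring, mul_eq_zero,
      or_iff_right (inv_ne_zero (hq i).ne')]
  simp only [hX, hU, hV, hHx, hHu]
  rw [c1, hD]
  simp only [Matrix.mulVec_diagonal]
  have c2 : ∀ i, (q i * deriv (fun s => F s (U i)) (X i) - ΨA i
        + Ψd i * deriv (fun s => f s (U i)) (X i) = 0) ↔
      (deriv (fun s => F s (U i)) (X i) + (q i)⁻¹ * Ψd i * deriv (fun s => f s (U i)) (X i)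
        - (q i)⁻¹ * ΨA i = 0) := by
    intro i
    have := (hq i).ne'
    rw [← mul_eq_zero_iff_left (inv_ne_zero this)]
    apply Eq.congr_left
    field_simp
    ring
  have c3 : ∀ i, (q i * deriv (fun s => F (X i) s) (U i)
        + Ψd i * deriv (fun s => f (X i) s) (U i) = 0) ↔
      (deriv (fun s => F (X i) s) (U i)
        + (q i)⁻¹ * Ψd i * deriv (fun s => f (X i) s) (U i) = 0) := by
    intro i
    have := (hq i).ne'
    rw [← mul_eq_zero_iff_left (inv_ne_zero this)]
    apply Eq.congr_left
    field_simp
  simp only [c2, c3]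
  tauto
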